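/- arXiv:1407.2496 — 2 statements merged into one kernel-verified Lean document; each statement's English description precedes it below -/
import Mathlib

section
/- Assume ζ_p ∈ K and let a ∈ K^× with v_K(a) = 0 and v_K(a − 1) = l, where 1 ≤ l < p·e_K/(p−1) and gcd(l, p) = 1. Then L = K(a^{1/p}) is a cyclic extension of K of degree p whose upper ramification jump equals p·e_K/(p−1) − l. -/
noncomputable section

open scoped Classical

namespace PaperRam

/-- An additive `ℤ ∪ {∞}`-valued valuation on a field is *normalized* if it is
surjective onto `ℤ`. -/
def IsNormalized {F : Type*} [Field F] (v : AddValuation F (WithTop ℤ)) : Prop :=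
  ∀ n : ℤ, ∃ x : F, v x = (n : WithTop ℤ)

/-- The normalized valuation `vF` of `F` extends the normalized valuation `vK` of `K`
with ramification index `e`, i.e. `vF(x) = e · vK(x)` for all `x ∈ K`. -/
def Extends {K F : Type*} [Field K] [Field F] [Algebra K F]
    (vK : AddValuation K (WithTop ℤ)) (vF : AddValuation F (WithTop ℤ)) (e : ℕ) : Prop :=
  0 < e ∧ ∀ x : K, vF (algebraMap K F x) = e • vK x

/-- `v` is the normalized valuation of the `p`-adic field `K`, with (absolute)
ramification index `eK` over `ℚ_p`. -/
def IsPadicValuation (p : ℕ) [Fact p.Prime] {K : Type*} [Field K] [Algebra ℚ_[p] K]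
    (v : AddValuation K (WithTop ℤ)) (eK : ℕ) : Prop :=
  IsNormalized v ∧ 0 < eK ∧
    ∀ x : ℚ_[p], x ≠ 0 → v (algebraMap ℚ_[p] K x) = ((eK * x.valuation : ℤ) : WithTop ℤ)

/-- The valuation `v` of `F` is invariant under all `K`-algebra automorphisms of `F`. -/
def GalInvariant (K : Type*) {F : Type*} [Field K] [Field F] [Algebra K F]
    (v : AddValuation F (WithTop ℤ)) : Prop :=
  ∀ (σ : F ≃ₐ[K] F) (x : F), v (σ x) = v x

variable {K F : Type*} [Field K] [Field F] [Algebra K F]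

/-- The lower-numbering ramification subgroup `G_i` of `Gal(F/K)`:
`σ ∈ G_i ↔ v(σ x − x) ≥ i + 1` for all `x` in the valuation ring of `F`. -/
def lowerRG (v : AddValuation F (WithTop ℤ)) (hv : GalInvariant K v) (i : ℤ) :
    Subgroup (F ≃ₐ[K] F) where
  carrier := {σ | ∀ x : F, 0 ≤ v x → ((i + 1 : ℤ) : WithTop ℤ) ≤ v (σ x - x)}
  one_mem' := by
    intro x _
    simp
  mul_mem' := by
    intro a b ha hb x hx
    have h1 : ((i + 1 : ℤ) : WithTop ℤ) ≤ v (a (b x) - b x) :=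
      ha (b x) (by rw [hv b x]; exact hx)
    have h2 := hb x hx
    have hrw : (a * b) x - x = (a (b x) - b x) + (b x - x) := by
      rw [AlgEquiv.mul_apply]; ring
    rw [hrw]
    exact v.map_le_add h1 h2
  inv_mem' := by
    intro a ha x hx
    have hda : a (a⁻¹ x - x) = x - a x := by
      rw [map_sub]
      congr 1
      exact a.apply_symm_apply x
    have : v (a⁻¹ x - x) = v (a x - x) := by
      rw [← hv a (a⁻¹ x - x), hda, v.map_sub_swap]
    rw [this]
    exact ha x hx

/-- The Herbrand function `φ_{F/K}` evaluated at integers. -/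
def herbrandPhi (v : AddValuation F (WithTop ℤ)) (hv : GalInvariant K v) (n : ℤ) : ℚ :=
  if n ≤ 0 then (n : ℚ)
  else (∑ i ∈ Finset.Icc (1 : ℤ) n, (Nat.card (lowerRG v hv i) : ℚ)) /
    (Nat.card (lowerRG v hv 0) : ℚ)

/-- The upper-numbering ramification subgroup `G^u = G_{ψ(u)}` of `Gal(F/K)`. -/
def upperRG (v : AddValuation F (WithTop ℤ)) (hv : GalInvariant K v) (u : ℤ) :
    Subgroup (F ≃ₐ[K] F) :=
  lowerRG v hv (sInf {n : ℤ | (u : ℚ) ≤ herbrandPhi v hv n})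

/-- `t` is an upper ramification jump of `F/K`: `G^u ≠ G^t` for every `u > t`. -/
def IsUpperJump (v : AddValuation F (WithTop ℤ)) (hv : GalInvariant K v) (t : ℤ) : Prop :=
  ∀ u : ℤ, t < u → upperRG v hv u ≠ upperRG v hv t

/-- A group is elementary abelian of exponent `p` if it is isomorphic to `(ℤ/pℤ)^k`
for some `k`. -/
def IsElemAbelian (p : ℕ) (G : Type*) [Group G] : Prop :=
  ∃ k : ℕ, Nonempty (G ≃* (Fin k → Multiplicative (ZMod p)))

/-- The norm group `N_{L/K}(L^×)`, as a subgroup of `K^×`. -/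
def normGroup (K L : Type*) [Field K] [Field L] [Algebra K L] : Subgroup Kˣ :=
  (Units.map (Algebra.norm K : L →* K)).range

/-- The residues of `c 0, …, c (f-1)` lie in the valuation ring and form a basis of
the residue field of `v` over `𝔽_p`. -/
def IsResidueBasis (p : ℕ) {K : Type*} [Field K] (v : AddValuation K (WithTop ℤ))
    {f : ℕ} (c : Fin f → K) : Prop :=
  (∀ y, 0 ≤ v (c y)) ∧
  (∀ a : Fin f → ℤ, (1 : WithTop ℤ) ≤ v (∑ y, (a y : K) * c y) → ∀ y, (p : ℤ) ∣ a y) ∧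
  (∀ x : K, 0 ≤ v x → ∃ a : Fin f → ℤ, (1 : WithTop ℤ) ≤ v (x - ∑ y, (a y : K) * c y))

/-- `v_L(𝒟_{L/K})`: the valuation of the different of `L/K`, defined through the
inverse different `{x ∈ L ∣ Tr_{L/K}(x·𝒪_L) ⊆ 𝒪_K} = 𝔪_L^{-d}`. -/
def differentVal (K : Type*) {L : Type*} [Field K] [Field L] [Algebra K L]
    (vK : AddValuation K (WithTop ℤ)) (vL : AddValuation L (WithTop ℤ)) : ℤ :=
  sSup {m : ℤ | ∃ x : L, vL x = ((-m : ℤ) : WithTop ℤ) ∧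
    ∀ y : L, 0 ≤ vL y → 0 ≤ vK (Algebra.trace K L (x * y))}

/-- The maximal elementary abelian `p`-extension `𝒞_K(p)` of `K` inside `Ω`: the
compositum of all cyclic (equivalently, normal) extensions of `K` of degree `p`. -/
def maxElemAbelian (p : ℕ) (K Ω : Type*) [Field K] [Field Ω] [Algebra K Ω] :
    IntermediateField K Ω :=
  ⨆ L ∈ {L : IntermediateField K Ω | Module.finrank K L = p ∧ Normal K L}, L

/-- The subgroup `U_K^{i+1} = 1 + 𝔪_K^{i+1}` of principal units of `K^×`
(the index is shifted by one so that `principalUnits v 0 = U_K^1`). -/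
def principalUnits {K : Type*} [Field K] (v : AddValuation K (WithTop ℤ)) (i : ℕ) :
    Subgroup Kˣ where
  carrier := {x : Kˣ | (((i : ℤ) + 1 : ℤ) : WithTop ℤ) ≤ v ((x : K) - 1)}
  one_mem' := by simp
  mul_mem' := by
    intro a b ha hb
    have hpos : (0 : WithTop ℤ) < (((i : ℤ) + 1 : ℤ) : WithTop ℤ) := by
      rw [show (0 : WithTop ℤ) = ((0 : ℤ) : WithTop ℤ) from rfl]
      exact WithTop.coe_lt_coe.mpr (by omega)
    have hva : v (a : K) = 0 := by
      have h1 : v ((1 : K)) < v ((a : K) - 1) := by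
        rw [v.map_one]; exact lt_of_lt_of_le hpos ha
      have h2 := v.map_add_eq_of_lt_right h1
      rw [sub_add_cancel] at h2
      rw [h2, v.map_one]
    have key : ((a * b : Kˣ) : K) - 1 = (a : K) * ((b : K) - 1) + ((a : K) - 1) := by
      push_cast; ring
    show (((i : ℤ) + 1 : ℤ) : WithTop ℤ) ≤ v (((a * b : Kˣ) : K) - 1)
    rw [key]
    refine v.map_le_add ?_ ha
    rw [v.map_mul, hva, zero_add]
    exact hb
  inv_mem' := by
    intro a ha
    have hpos : (0 : WithTop ℤ) < (((i : ℤ) + 1 : ℤ) : WithTop ℤ) := by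
      rw [show (0 : WithTop ℤ) = ((0 : ℤ) : WithTop ℤ) from rfl]
      exact WithTop.coe_lt_coe.mpr (by omega)
    have hva : v (a : K) = 0 := by
      have h1 : v ((1 : K)) < v ((a : K) - 1) := by
        rw [v.map_one]; exact lt_of_lt_of_le hpos ha
      have h2 := v.map_add_eq_of_lt_right h1
      rw [sub_add_cancel] at h2
      rw [h2, v.map_one]
    have key : ((a⁻¹ : Kˣ) : K) - 1 = ((a : K))⁻¹ * (1 - (a : K)) := by
      rw [mul_sub, mul_one, inv_mul_cancel₀ (Units.ne_zero a)]
      push_cast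
      ring
    show (((i : ℤ) + 1 : ℤ) : WithTop ℤ) ≤ v (((a⁻¹ : Kˣ) : K) - 1)
    rw [key, v.map_mul, v.map_inv, hva, v.map_sub_swap]
    simpa using ha


section Valuation

variable {F : Type*} [Field F] (v : AddValuation F (WithTop ℤ))

lemma exists_coe_eq {x : F} (hx : x ≠ 0) : ∃ n : ℤ, v x = n := by
  obtain ⟨n, hn⟩ := WithTop.ne_top_iff_exists.mp (mt v.top_iff.mp hx)
  exact ⟨n, hn.symm⟩

lemma map_pow_of_eq {x : F} {n : ℤ} (hx : v x = n) (k : ℕ) :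
    v (x ^ k) = ((k * n : ℤ) : WithTop ℤ) := by
  rw [v.map_pow, hx, ← WithTop.coe_nsmul, nsmul_eq_mul]

lemma zero_le_map_natCast (n : ℕ) : 0 ≤ v (n : F) := by
  induction n with
  | zero => simp
  | succ n ih =>
    rw [Nat.cast_succ]
    exact v.map_le_add ih v.map_one.ge

/-- If the nonzero terms of a finite sum have pairwise distinct valuations, a lower bound for the
valuation of the sum is a lower bound for the valuation of every term. -/
lemma le_map_of_le_map_sum {ι : Type*} [Fintype ι] {f : ι → F}
    (hf : ∀ i j, i ≠ j → f i ≠ 0 → v (f i) ≠ v (f j)) {n : WithTop ℤ}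
    (hn : n ≤ v (∑ i, f i)) (i : ι) : n ≤ v (f i) := by
  obtain ⟨j, -, hj⟩ := Finset.exists_min_image Finset.univ (fun k => v (f k)) ⟨i, Finset.mem_univ i⟩
  refine le_trans ?_ (hj i (Finset.mem_univ i))
  by_cases h0 : f j = 0
  · simp [h0]
  have hlt : v (f j) < v (∑ k ∈ Finset.univ.erase j, f k) := by
    refine v.map_lt_sum (mt v.top_iff.mp h0) fun k hk => ?_
    exact lt_of_le_of_ne (hj k (Finset.mem_univ k)) (hf j k (Finset.ne_of_mem_erase hk).symm h0)
  rwa [← Finset.add_sum_erase _ _ (Finset.mem_univ j), v.map_add_eq_of_lt_left hlt] at hn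

lemma exists_one_add_pow_eq (p : ℕ) [hp : Fact p.Prime] {y : F} (hy : 0 ≤ v y) :
    ∃ S : F, 0 ≤ v S ∧ (0 < v y → v S = 0) ∧ (1 + y) ^ p = 1 + y ^ p + p * y * S := by
  have hpow (k : ℕ) : 0 ≤ v (y ^ k) := by
    rw [v.map_pow]; exact nsmul_nonneg hy k
  have hterm (k : ℕ) : 0 ≤ v (y ^ (k - 1) * ((p.choose k / p : ℕ) : F)) := by
    rw [v.map_mul]; exact add_nonneg (hpow _) (zero_le_map_natCast v _)
  refine ⟨∑ k ∈ Finset.Ioo 0 p, y ^ (k - 1) * ((p.choose k / p : ℕ) : F),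
    v.map_le_sum fun k _ => hterm k, fun hpos => ?_, ?_⟩
  · have h1 : 1 ∈ Finset.Ioo 0 p := by simp [hp.out.one_lt]
    rw [← Finset.add_sum_erase _ _ h1]
    have hone : y ^ (1 - 1) * ((p.choose 1 / p : ℕ) : F) = 1 := by
      simp [Nat.div_self hp.out.pos]
    rw [hone, v.map_add_eq_of_lt_left, v.map_one]
    rw [v.map_one]
    refine v.map_lt_sum (by simp) fun k hk => ?_
    have hk1 : k ≠ 1 := Finset.ne_of_mem_erase hk
    have hk0 : 0 < k := (Finset.mem_Ioo.mp (Finset.mem_of_mem_erase hk)).1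
    obtain ⟨m, rfl⟩ : ∃ m, k = m + 2 := ⟨k - 2, by omega⟩
    rw [show m + 2 - 1 = m + 1 from rfl, pow_succ, mul_right_comm, v.map_mul]
    refine hpos.trans_le (le_add_of_nonneg_left ?_)
    rw [v.map_mul]
    exact add_nonneg (hpow _) (zero_le_map_natCast v _)
  · rw [add_comm 1 y, add_pow_prime_eq hp.out]
    simp [add_comm (y ^ p)]

lemma map_pos_of_one_add_pow (p : ℕ) [hp : Fact p.Prime] {y : F} (hvp : 0 < v (p : F))
    (hy : 0 ≤ v y) (h : 0 < v ((1 + y) ^ p - 1)) : 0 < v y := by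
  obtain ⟨S, hS, -, hSe⟩ := exists_one_add_pow_eq v p hy
  have hyp : y ^ p = ((1 + y) ^ p - 1) - p * y * S := by rw [hSe]; ring
  have hpS : 0 < v (p * y * S) := by
    rw [v.map_mul, v.map_mul]
    exact add_pos_of_pos_of_nonneg (add_pos_of_pos_of_nonneg hvp hy) hS
  have : 0 < v (y ^ p) := by
    rw [hyp, sub_eq_add_neg]
    exact v.map_lt_add h (by rwa [v.map_neg])
  rw [v.map_pow] at this
  rcases hy.eq_or_lt with h0 | h0
  · simp [← h0] at this
  · exact h0

lemma map_pow_add_eq (p : ℕ) [hp : Fact p.Prime] {E b : ℤ} {y : F} (hvp : v (p : F) = E)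
    (hy : v y = b) (hb : 0 < b) :
    ∃ w : F, (1 + y) ^ p - 1 = y ^ p + w ∧ v (y ^ p) = ((p * b : ℤ) : WithTop ℤ) ∧
      v w = ((E + b : ℤ) : WithTop ℤ) := by
  have hpos : 0 < v y := by rw [hy]; exact_mod_cast hb
  obtain ⟨S, -, hS, hSe⟩ := exists_one_add_pow_eq v p hpos.le
  refine ⟨p * y * S, by rw [hSe]; ring, map_pow_of_eq v hy p, ?_⟩
  rw [v.map_mul, v.map_mul, hS hpos, hvp, hy, add_zero, WithTop.coe_add]

/-- If `1 + y` is a `p`-th root of unity then `(p - 1) v(y) = v(p)`. -/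
lemma sub_one_mul_map_eq_of_one_add_pow_eq_one (p : ℕ) [hp : Fact p.Prime] {E b : ℤ} {y : F}
    (hvp : v (p : F) = E) (hy : v y = b) (hb : 0 < b) (h : (1 + y) ^ p = 1) :
    ((p : ℤ) - 1) * b = E := by
  obtain ⟨w, hw, h1, h2⟩ := map_pow_add_eq v p hvp hy hb
  rw [h, sub_self] at hw
  have : v (y ^ p) = v w := by rw [eq_neg_of_add_eq_zero_left hw.symm, v.map_neg]
  rw [h1, h2, WithTop.coe_inj] at this
  linarith

lemma mul_map_eq_of_map_one_add_pow_sub_one (p : ℕ) [hp : Fact p.Prime] {E b c : ℤ} {y : F}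
    (hvp : v (p : F) = E) (hy : v y = b) (hb : 0 < b) (h : v ((1 + y) ^ p - 1) = c)
    (hc : ((p : ℤ) - 1) * c < p * E) : p * b = c := by
  obtain ⟨w, hw, h1, h2⟩ := map_pow_add_eq v p hvp hy hb
  have hp1 : (1 : ℤ) < p := by exact_mod_cast hp.out.one_lt
  rcases lt_or_ge (p * b) (E + b) with hlt | hge
  · rw [hw, v.map_add_eq_of_lt_left (by rw [h1, h2]; exact_mod_cast hlt), h1,
      WithTop.coe_inj] at h
    exact h
  · have : ((E + b : ℤ) : WithTop ℤ) ≤ v ((1 + y) ^ p - 1) := by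
      rw [hw]
      exact v.map_le_add (by rw [h1]; exact_mod_cast hge) h2.ge
    rw [h, WithTop.coe_le_coe] at this
    nlinarith

lemma le_map_pow_sub_pow {x y : F} {m t : ℤ} (hx : v x = m) (hy : v y = m)
    (h : ((m + t : ℤ) : WithTop ℤ) ≤ v (y - x)) (i : ℕ) :
    ((i * m + t : ℤ) : WithTop ℤ) ≤ v (y ^ i - x ^ i) := by
  induction i with
  | zero => simp
  | succ i ih =>
    rw [show y ^ (i + 1) - x ^ (i + 1) = (y ^ i - x ^ i) * y + x ^ i * (y - x) by ring]
    refine v.map_le_add ?_ ?_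
    · rw [v.map_mul, hy, show ((i + 1 : ℕ) * m + t : ℤ) = (i * m + t) + m by push_cast; ring,
        WithTop.coe_add]
      gcongr
    · rw [v.map_mul, map_pow_of_eq v hx,
        show ((i + 1 : ℕ) * m + t : ℤ) = i * m + (m + t) by push_cast; ring, WithTop.coe_add]
      gcongr

end Valuation

section Extension

variable {vK : AddValuation K (WithTop ℤ)} {vF : AddValuation F (WithTop ℤ)} {e : ℕ}

lemma Extends.map_eq (hext : Extends vK vF e) {x : K} {n : ℤ} (hx : vK x = n) :
    vF (algebraMap K F x) = ((e * n : ℤ) : WithTop ℤ) := by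
  rw [hext.2, hx, ← WithTop.coe_nsmul, nsmul_eq_mul]

lemma Extends.le_map_smul_of_le_map_sum (hext : Extends vK vF e) {ι : Type*} [Fintype ι]
    {w : ι → F} {k : ι → ℤ} (hw : ∀ i, vF (w i) = k i)
    (hk : ∀ i j, i ≠ j → ¬ (e : ℤ) ∣ k i - k j) (c : ι → K) {n : WithTop ℤ}
    (hn : n ≤ vF (∑ i, c i • w i)) (i : ι) : n ≤ vF (c i • w i) := by
  refine le_map_of_le_map_sum vF (fun i j hij h0 h => ?_) hn i
  have hc (i : ι) (h0 : c i ≠ 0) : ∃ m : ℤ, vF (c i • w i) = ((e * m + k i : ℤ) : WithTop ℤ) := by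
    obtain ⟨m, hm⟩ := exists_coe_eq vK h0
    exact ⟨m, by rw [Algebra.smul_def, vF.map_mul, hext.map_eq hm, hw, WithTop.coe_add]⟩
  obtain ⟨m, hm⟩ := hc i (left_ne_zero_of_smul h0)
  have hj : c j ≠ 0 := by
    rintro h'
    rw [hm, h', zero_smul, vF.map_zero] at h
    exact WithTop.coe_ne_top h
  obtain ⟨m', hm'⟩ := hc j hj
  rw [hm, hm', WithTop.coe_inj] at h
  exact hk i j hij ⟨m' - m, by linarith⟩

lemma Extends.linearIndependent (hext : Extends vK vF e) {ι : Type*} [Fintype ι]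
    {w : ι → F} {k : ι → ℤ} (hw : ∀ i, vF (w i) = k i)
    (hk : ∀ i j, i ≠ j → ¬ (e : ℤ) ∣ k i - k j) : LinearIndependent K w := by
  rw [Fintype.linearIndependent_iff]
  intro c hc i
  have h := hext.le_map_smul_of_le_map_sum hw hk c (n := ⊤) (by rw [hc, vF.map_zero]) i
  have hwi : w i ≠ 0 := by
    intro h'
    have := hw i
    rw [h', vF.map_zero] at this
    exact WithTop.coe_ne_top this.symm
  exact (smul_eq_zero.mp (vF.top_iff.mp (top_le_iff.mp h))).resolve_right hwi

lemma Extends.le_finrank [FiniteDimensional K F] (hext : Extends vK vF e)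
    (hvF : IsNormalized vF) : e ≤ Module.finrank K F := by
  obtain ⟨x, hx⟩ := hvF 1
  have hli : LinearIndependent K (fun i : Fin e => x ^ (i : ℕ)) := by
    refine hext.linearIndependent (k := fun i => (i : ℕ) * 1) (fun i => map_pow_of_eq vF hx i) ?_
    intro i j hij hdvd
    have hi := i.isLt
    have hj := j.isLt
    have : (i : ℤ) * 1 - (j : ℤ) * 1 = 0 :=
      Int.eq_zero_of_abs_lt_dvd hdvd (by rw [abs_lt]; constructor <;> omega)
    exact hij (Fin.ext (by omega))
  simpa using hli.fintype_card_le_finrank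

end Extension

section Ramification

variable (v : AddValuation F (WithTop ℤ)) (hv : GalInvariant K v)

lemma mem_lowerRG {i : ℤ} {σ : F ≃ₐ[K] F} :
    σ ∈ lowerRG v hv i ↔ ∀ x : F, 0 ≤ v x → ((i + 1 : ℤ) : WithTop ℤ) ≤ v (σ x - x) :=
  Iff.rfl

/-- An automorphism that moves `β` with `v (σ β - β) = v β + t` is not in `G_i` for `i > t`. -/
lemma notMem_lowerRG_of_map_sub_eq (hn : IsNormalized v) {σ : F ≃ₐ[K] F} {β : F} {l : ℕ} {t i : ℤ}
    (hβ : v β = ((l : ℤ) : WithTop ℤ)) (hσ : v (σ β - β) = ((l + t : ℤ) : WithTop ℤ))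
    (hi : t < i) : σ ∉ lowerRG v hv i := by
  intro hmem
  rw [mem_lowerRG] at hmem
  obtain ⟨x, hx⟩ := hn 1
  have hx0 : x ≠ 0 := by
    rintro rfl
    rw [v.map_zero] at hx
    exact WithTop.coe_ne_top hx.symm
  have hσx : v (σ x) = ((1 : ℤ) : WithTop ℤ) := by rw [hv, hx]
  have hpow := le_map_pow_sub_pow v (t := i) hx hσx
    (by rw [add_comm]; exact hmem x (by rw [hx]; exact_mod_cast zero_le_one)) l
  obtain ⟨u, rfl⟩ : ∃ u, β = u * x ^ l := ⟨β / x ^ l, by field_simp⟩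
  have hxl := map_pow_of_eq v hx l
  have hu : v u = 0 := by
    rw [v.map_mul, hxl] at hβ
    obtain ⟨n, hun⟩ := exists_coe_eq v (x := u) (by
      rintro rfl
      rw [v.map_zero, top_add] at hβ
      exact WithTop.coe_ne_top hβ.symm)
    rw [hun, ← WithTop.coe_add, WithTop.coe_inj] at hβ
    rw [hun]
    exact_mod_cast (by linarith : n = 0)
  have hle : ((l + i : ℤ) : WithTop ℤ) ≤ v (σ (u * x ^ l) - u * x ^ l) := by
    rw [show σ (u * x ^ l) - u * x ^ l = σ u * (σ x ^ l - x ^ l) + (σ u - u) * x ^ l by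
      rw [map_mul, map_pow]; ring]
    refine v.map_le_add ?_ ?_
    · rw [v.map_mul, hv, hu, zero_add]
      simpa using hpow
    · rw [v.map_mul, hxl]
      refine le_trans ?_ (add_le_add_left (hmem u hu.ge) _)
      rw [← WithTop.coe_add, WithTop.coe_le_coe]
      linarith
  rw [hσ, WithTop.coe_le_coe] at hle
  linarith

variable {v hv}

lemma isUpperJump_iff_of_lowerRG [Finite (F ≃ₐ[K] F)] [Nontrivial (F ≃ₐ[K] F)] {t : ℤ}
    (ht : 1 ≤ t) (htop : ∀ i ≤ t, lowerRG v hv i = ⊤) (hbot : ∀ i, t < i → lowerRG v hv i = ⊥)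
    (s : ℤ) : IsUpperJump v hv s ↔ s = t := by
  set g : ℚ := (Nat.card (F ≃ₐ[K] F) : ℚ) with hg
  have hg0 : 0 < g := by rw [hg]; exact_mod_cast Nat.card_pos
  have hphi_le (n : ℤ) (hn : n ≤ t) : herbrandPhi v hv n = n := by
    unfold herbrandPhi
    split_ifs with h0
    · rfl
    · rw [Finset.sum_congr rfl (g := fun _ => g), htop 0 (by omega)]
      · rw [Finset.sum_const, Int.card_Icc, Subgroup.card_top, ← hg, nsmul_eq_mul,
          mul_div_assoc, div_self hg0.ne', mul_one]
        have : ((n + 1 - 1).toNat : ℤ) = n := by omega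
        exact_mod_cast this
      · intro i hi
        rw [htop i (by rw [Finset.mem_Icc] at hi; omega), Subgroup.card_top]
  have hphi_gt (k : ℕ) : herbrandPhi v hv (t + k) = t + k / g := by
    have hsum : ∑ i ∈ Finset.Icc (1 : ℤ) (t + k), (Nat.card (lowerRG v hv i) : ℚ) =
        t * g + k := by
      induction k with
      | zero =>
        have := hphi_le t le_rfl
        rw [herbrandPhi, if_neg (by omega), htop 0 (by omega), Subgroup.card_top, ← hg,
          div_eq_iff hg0.ne'] at this
        simpa using this
      | succ k ih =>
        rw [show t + ((k + 1 : ℕ) : ℤ) = Order.succ (t + k) by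
            rw [Order.succ_eq_add_one]; push_cast; ring,
          ← Finset.insert_Icc_right_eq_Icc_succ (by
            rw [Order.succ_eq_add_one]; omega), Finset.sum_insert (by
            rw [Order.succ_eq_add_one, Finset.mem_Icc]; omega), ih,
          hbot _ (by rw [Order.succ_eq_add_one]; omega), Subgroup.card_bot]
        push_cast
        ring
    rw [herbrandPhi, if_neg (by omega), hsum, htop 0 (by omega), Subgroup.card_top, ← hg]
    field_simp
  have hup_le (u : ℤ) (hu : u ≤ t) : upperRG v hv u = ⊤ := by
    refine htop _ ((csInf_le ⟨u, fun n hn => ?_⟩ ?_).trans hu)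
    · by_contra hlt
      rw [Set.mem_ofPred_eq, hphi_le n (by omega)] at hn
      exact hlt (by exact_mod_cast hn)
    · rw [Set.mem_ofPred_eq, hphi_le u hu]
  have hup_gt (u : ℤ) (hu : t < u) : upperRG v hv u = ⊥ := by
    have hmem : t + (((u - t).toNat * Nat.card (F ≃ₐ[K] F) : ℕ) : ℤ) ∈
        {n : ℤ | (u : ℚ) ≤ herbrandPhi v hv n} := by
      rw [Set.mem_ofPred_eq, hphi_gt]
      rw [Nat.cast_mul, ← hg, mul_div_assoc, div_self hg0.ne', mul_one]
      have : u ≤ t + ((u - t).toNat : ℤ) := by omega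
      exact_mod_cast this
    refine hbot _ (Int.lt_iff_add_one_le.mpr (le_csInf ⟨_, hmem⟩ fun n hn => ?_))
    by_contra hlt
    rw [Set.mem_ofPred_eq, hphi_le n (by omega)] at hn
    have : u ≤ n := by exact_mod_cast hn
    omega
  constructor
  · intro h
    rcases lt_trichotomy s t with hs | hs | hs
    · exact absurd ((hup_le t le_rfl).trans (hup_le s hs.le).symm) (h t hs)
    · exact hs
    · exact absurd ((hup_gt (s + 1) (by omega)).trans (hup_gt s hs).symm) (h _ (by omega))
  · rintro rfl u hu
    rw [hup_gt u hu, hup_le s le_rfl]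
    exact bot_ne_top

end Ramification

section Kummer

variable {p : ℕ} [Fact p.Prime] {vK : AddValuation K (WithTop ℤ)} {v : AddValuation F (WithTop ℤ)}
  {e : ℕ} {a : K} {α : F}

lemma IsPadicValuation.map_natCast_prime [Algebra ℚ_[p] K] {eK : ℕ}
    (hvK : IsPadicValuation p vK eK) : vK (p : K) = ((eK : ℤ) : WithTop ℤ) := by
  have h := hvK.2.2 (p : ℚ_[p]) (by exact_mod_cast (Fact.out : p.Prime).ne_zero)
  rwa [Padic.valuation_p, map_natCast, mul_one] at h

/-- If `α ^ p = a` with `v_K(a) = 0` and `v_K(a - 1) = l` in the range of interest, then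
`p · v(α - 1) = e · l`. -/
lemma Extends.exists_map_sub_one_eq (hext : Extends vK v e) {E : ℕ} (hE : 0 < E)
    (hvp : vK (p : K) = ((E : ℤ) : WithTop ℤ)) (ha0 : vK a = ((0 : ℤ) : WithTop ℤ)) {l : ℕ}
    (hl1 : 1 ≤ l) (hl2 : (p - 1) * l < p * E) (hal : vK (a - 1) = ((l : ℤ) : WithTop ℤ))
    (hα : α ^ p = algebraMap K F a) :
    v α = 0 ∧ ∃ b : ℤ, 0 < b ∧ v (α - 1) = (b : WithTop ℤ) ∧ (p * b : ℤ) = e * l := by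
  have hp : p.Prime := Fact.out
  have he : 0 < e := hext.1
  have hvp' : v (p : F) = ((e * E : ℤ) : WithTop ℤ) := by
    rw [← map_natCast (algebraMap K F)]; exact hext.map_eq hvp
  have hvα : v α = 0 := by
    have h : v (α ^ p) = ((e * 0 : ℤ) : WithTop ℤ) := by rw [hα]; exact hext.map_eq ha0
    obtain ⟨n, hn⟩ := exists_coe_eq v (x := α) (by
      rintro rfl
      rw [zero_pow hp.ne_zero, v.map_zero] at h
      exact WithTop.coe_ne_top h.symm)
    rw [map_pow_of_eq v hn, WithTop.coe_inj, mul_zero] at h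
    rw [hn]
    exact_mod_cast (mul_eq_zero.mp h).resolve_left (by exact_mod_cast hp.ne_zero)
  have hval : v ((1 + (α - 1)) ^ p - 1) = ((e * l : ℤ) : WithTop ℤ) := by
    rw [add_sub_cancel, hα, ← map_one (algebraMap K F), ← map_sub]
    exact hext.map_eq hal
  have hel : (0 : ℤ) < e * l := by positivity
  have hpos : 0 < v (α - 1) := by
    refine map_pos_of_one_add_pow v p ?_ (v.map_le_sub hvα.ge v.map_one.ge) ?_
    · rw [hvp']; exact_mod_cast (by positivity : 0 < e * E)
    · rw [hval]; exact_mod_cast hel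
  obtain ⟨b, hb⟩ := exists_coe_eq v (x := α - 1) (by
    intro h
    rw [h, add_zero, one_pow, sub_self, v.map_zero] at hval
    exact WithTop.coe_ne_top hval.symm)
  have hb0 : 0 < b := by rw [hb] at hpos; exact_mod_cast hpos
  refine ⟨hvα, b, hb0, hb, mul_map_eq_of_map_one_add_pow_sub_one v p hvp' hb hb0 hval ?_⟩
  have hl2' : ((p : ℤ) - 1) * l < p * E := by
    zify [hp.one_le] at hl2
    exact hl2
  have : (0 : ℤ) < e := by exact_mod_cast he
  nlinarith

/-- A ramified extension obtained by adjoining a `p`-th root of `a` is cyclic of degree `p`. -/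
lemma Extends.finrank_eq_and_isCyclic (hext : Extends vK v e)
    (hv : IsNormalized v) (he : e ≠ 1) {ζ : K} (hζ : IsPrimitiveRoot ζ p)
    (hα : α ^ p = algebraMap K F a) (htop : IntermediateField.adjoin K {α} = ⊤) :
    Module.finrank K F = p ∧ IsGalois K F ∧ IsCyclic (F ≃ₐ[K] F) := by
  have hp : p.Prime := Fact.out
  have hirr : Irreducible (Polynomial.X ^ p - Polynomial.C a) := by
    refine X_pow_sub_C_irreducible_of_prime hp fun c hc => he ?_
    have : NeZero p := ⟨hp.ne_zero⟩
    have hαc : α ∈ (⊥ : IntermediateField K F) := by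
      rw [IntermediateField.mem_bot]
      by_cases hc0 : c = 0
      · refine ⟨0, ?_⟩
        rw [← hc, hc0, zero_pow hp.ne_zero, map_zero] at hα
        rw [map_zero, eq_zero_of_pow_eq_zero hα]
      have h : (α / algebraMap K F c) ^ p = 1 := by
        rw [div_pow, hα, ← map_pow, hc, div_self]
        rw [Ne, map_eq_zero, ← hc]
        exact pow_ne_zero p hc0
      obtain ⟨i, -, hi⟩ :=
        (hζ.map_of_injective (algebraMap K F).injective).eq_pow_of_pow_eq_one h
      refine ⟨ζ ^ i * c, ?_⟩
      rw [map_mul, map_pow, hi, div_mul_cancel₀]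
      rwa [Ne, map_eq_zero]
    have hsurj (x : F) : ∃ y : K, algebraMap K F y = x := by
      have hx : x ∈ (⊥ : IntermediateField K F) := by
        have := IntermediateField.adjoin_simple_eq_bot_iff.mpr hαc
        rw [← this, htop]
        trivial
      exact IntermediateField.mem_bot.mp hx
    obtain ⟨x, hx⟩ := hv 1
    obtain ⟨y, rfl⟩ := hsurj x
    obtain ⟨n, hn⟩ := exists_coe_eq vK (x := y) (by
      rintro rfl
      rw [map_zero, v.map_zero] at hx
      exact WithTop.coe_ne_top hx.symm)
    rw [hext.map_eq hn, WithTop.coe_inj] at hx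
    have := Int.eq_one_or_neg_one_of_mul_eq_one hx
    omega
  have hint : IsIntegral K α := by
    refine IsIntegral.of_pow hp.pos ?_
    rw [hα]
    exact isIntegral_algebraMap
  have hmin : minpoly K α = Polynomial.X ^ p - Polynomial.C a :=
    (minpoly.eq_of_irreducible_of_monic hirr (by simp [hα])
      (Polynomial.monic_X_pow_sub_C a hp.ne_zero)).symm
  have hfin : Module.finrank K F = p := by
    rw [← IntermediateField.finrank_top', ← htop, IntermediateField.adjoin.finrank hint, hmin,
      Polynomial.natDegree_X_pow_sub_C]
  have hroots : (primitiveRoots p K).Nonempty := ⟨ζ, (mem_primitiveRoots hp.pos).mpr hζ⟩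
  have : FiniteDimensional K F :=
    Module.finite_of_finrank_pos (by rw [hfin]; exact hp.pos)
  have hsplit : (Polynomial.X ^ p - Polynomial.C a).IsSplittingField K F := by
    have := isSplittingField_X_pow_sub_C_of_root_adjoin_eq_top (K := K) (L := F) (a := a) (α := α)
      (by rwa [hfin]) (by rwa [hfin]) htop
    rwa [hfin] at this
  have : NeZero p := ⟨hp.ne_zero⟩
  exact ⟨hfin, isGalois_of_isSplittingField_X_pow_sub_C hroots hirr F,
    isCyclic_of_isSplittingField_X_pow_sub_C hroots hirr F⟩

/-- An automorphism of `K(a^{1/p})` multiplies `a^{1/p}` by a `p`-th root of unity of `K`. -/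
lemma exists_pow_eq_one_and_map_eq {ζ : K} (hζ : IsPrimitiveRoot ζ p) (ha : a ≠ 0)
    (hα : α ^ p = algebraMap K F a) (σ : F ≃ₐ[K] F) :
    ∃ η : K, η ^ p = 1 ∧ σ α = algebraMap K F η * α := by
  have hp : p.Prime := Fact.out
  have : NeZero p := ⟨hp.ne_zero⟩
  have hα0 : α ≠ 0 := by
    rintro rfl
    rw [zero_pow hp.ne_zero, eq_comm, map_eq_zero] at hα
    exact ha hα
  have h : (σ α / α) ^ p = 1 := by
    rw [div_pow, ← map_pow, hα, σ.commutes, div_self]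
    rwa [Ne, map_eq_zero]
  obtain ⟨i, -, hi⟩ := (hζ.map_of_injective (algebraMap K F).injective).eq_pow_of_pow_eq_one h
  refine ⟨ζ ^ i, ?_, ?_⟩
  · rw [← pow_mul, mul_comm, pow_mul, hζ.pow_eq_one, one_pow]
  · rw [map_pow, hi, div_mul_cancel₀ _ hα0]

/-- If `p ∤ l = v(β)` and `v(σ β - β) ≥ l + t`, then `σ ∈ G_i` for all `i ≤ t`. -/
lemma Extends.mem_lowerRG_of_le_map_sub (hext : Extends vK v p) (hv : GalInvariant K v)
    (hfin : Module.finrank K F = p) {β : F} {l : ℕ} (hl : Nat.Coprime l p)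
    (hβ : v β = ((l : ℤ) : WithTop ℤ)) {σ : F ≃ₐ[K] F} {t : ℤ}
    (hσ : ((l + t : ℤ) : WithTop ℤ) ≤ v (σ β - β)) {i : ℤ} (hi : i ≤ t) :
    σ ∈ lowerRG v hv i := by
  have hp : p.Prime := Fact.out
  have hw (j : Fin p) : v (β ^ (j : ℕ)) = ((((j : ℕ) : ℤ) * l : ℤ) : WithTop ℤ) :=
    map_pow_of_eq v hβ j
  have hcop : IsCoprime (p : ℤ) (l : ℤ) := (Nat.isCoprime_iff_coprime.mpr hl).symm
  have hk (j j' : Fin p) (hj : j ≠ j') :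
      ¬ (p : ℤ) ∣ ((j : ℕ) : ℤ) * l - ((j' : ℕ) : ℤ) * l := by
    intro hdvd
    rw [← sub_mul] at hdvd
    have h1 := j.isLt
    have h2 := j'.isLt
    have := Int.eq_zero_of_abs_lt_dvd (hcop.dvd_of_dvd_mul_right hdvd)
      (by rw [abs_lt]; constructor <;> omega)
    exact hj (Fin.ext (by omega))
  have : Nonempty (Fin p) := ⟨⟨0, hp.pos⟩⟩
  have hσβ : v (σ β) = ((l : ℤ) : WithTop ℤ) := by rw [hv, hβ]
  let B := basisOfLinearIndependentOfCardEqFinrank (hext.linearIndependent hw hk)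
    (by rw [hfin, Fintype.card_fin])
  rw [mem_lowerRG]
  intro x hx
  obtain ⟨c, rfl⟩ : ∃ c : Fin p → K, x = ∑ j, c j • β ^ (j : ℕ) :=
    ⟨B.repr x, by simpa [B] using (B.sum_repr x).symm⟩
  have hterm := hext.le_map_smul_of_le_map_sum hw hk c hx
  rw [map_sum, ← Finset.sum_sub_distrib]
  refine v.map_le_sum fun j _ => ?_
  rw [map_smul, map_pow, ← smul_sub]
  by_cases hc : c j = 0
  · simp [hc]
  by_cases hj : (j : ℕ) = 0
  · simp [hj]
  obtain ⟨m, hm⟩ := exists_coe_eq vK hc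
  have hcm := hext.map_eq hm
  have h0 : 0 ≤ (p : ℤ) * m + ((j : ℕ) : ℤ) * l := by
    have := hterm j
    rw [Algebra.smul_def, v.map_mul, hcm, hw, ← WithTop.coe_add] at this
    exact_mod_cast this
  have hne : (p : ℤ) * m + ((j : ℕ) : ℤ) * l ≠ 0 := by
    intro h
    refine hk j ⟨0, hp.pos⟩ (fun h' => hj (congrArg Fin.val h')) ⟨-m, ?_⟩
    simp only [Nat.cast_zero, zero_mul]
    linarith
  rw [Algebra.smul_def, v.map_mul, hcm]
  refine le_trans ?_ (add_le_add_right (le_map_pow_sub_pow v hβ hσβ hσ j) _)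
  rw [← WithTop.coe_add, WithTop.coe_le_coe]
  omega

theorem Extends.kummer_upperJump [FiniteDimensional K F] {E : ℕ} (hE : 0 < E)
    (hvp : vK (p : K) = ((E : ℤ) : WithTop ℤ))
    {ζ : K} (hζ : IsPrimitiveRoot ζ p) {t' : ℤ} (ht' : ((p : ℤ) - 1) * t' = (p : ℤ) * E)
    (ha0 : vK a = ((0 : ℤ) : WithTop ℤ)) {l : ℕ} (hl1 : 1 ≤ l) (hl2 : (p - 1) * l < p * E)
    (hlp : Nat.Coprime l p) (hal : vK (a - 1) = ((l : ℤ) : WithTop ℤ))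
    (hα : α ^ p = algebraMap K F a) (htop : IntermediateField.adjoin K {α} = ⊤)
    (hext : Extends vK v e) (hvn : IsNormalized v) (hv : GalInvariant K v) :
    Module.finrank K F = p ∧ IsCyclic (F ≃ₐ[K] F) ∧
      ∀ s : ℤ, IsUpperJump v hv s ↔ s = t' - l := by
  have hp : p.Prime := Fact.out
  have hp1 : (1 : ℤ) < p := by exact_mod_cast hp.one_lt
  obtain ⟨hvα, b, hb0, hb, hpb⟩ := hext.exists_map_sub_one_eq hE hvp ha0 hl1 hl2 hal hα
  have hpe : p ∣ e := by
    have : (p : ℤ) ∣ e * l := ⟨b, hpb.symm⟩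
    exact hlp.symm.dvd_of_dvd_mul_right (by exact_mod_cast this)
  obtain ⟨hfin, hgal, hcyc⟩ := hext.finrank_eq_and_isCyclic hvn
    (by rintro rfl; exact hp.one_lt.ne' (Nat.dvd_one.mp hpe)) hζ hα htop
  obtain rfl : e = p := le_antisymm (hfin ▸ hext.le_finrank hvn) (Nat.le_of_dvd hext.1 hpe)
  obtain rfl : b = l := mul_left_cancel₀ (by omega) hpb
  refine ⟨hfin, hcyc, ?_⟩
  have ht : 1 ≤ t' - l := by
    have : ((e : ℤ) - 1) * l < e * E := by
      zify [hp.one_le] at hl2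
      exact hl2
    rw [← ht'] at this
    linarith [lt_of_mul_lt_mul_left this (by omega)]
  have hmove (σ : F ≃ₐ[K] F) (hσ : σ ≠ 1) :
      v (σ (α - 1) - (α - 1)) = ((l + (t' - l) : ℤ) : WithTop ℤ) := by
    have ha : a ≠ 0 := by
      rintro rfl
      rw [vK.map_zero] at ha0
      exact WithTop.coe_ne_top ha0.symm
    obtain ⟨η, hη, hση⟩ := exists_pow_eq_one_and_map_eq hζ ha hα σ
    have hη1 : η - 1 ≠ 0 := by
      intro h
      rw [sub_eq_zero.mp h, map_one, one_mul] at hση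
      refine hσ (AlgEquiv.ext fun x => ?_)
      have hx : x ∈ IntermediateField.adjoin K {α} := by rw [htop]; trivial
      induction hx using IntermediateField.adjoin_induction with
      | mem y hy => rw [Set.mem_singleton_iff.mp hy, hση]; rfl
      | algebraMap y => exact σ.commutes y
      | add y z _ _ hy hz => rw [map_add, map_add, hy, hz]
      | inv y _ hy => rw [map_inv₀, map_inv₀, hy]
      | mul y z _ _ hy hz => rw [map_mul, map_mul, hy, hz]
    obtain ⟨d, hd⟩ := exists_coe_eq vK hη1
    have hvη : 0 ≤ vK η := by
      by_contra! hlt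
      have h := congrArg vK hη
      have hη0 : η ≠ 0 := by
        rintro rfl
        simp at hlt
      obtain ⟨n, hn⟩ := exists_coe_eq vK hη0
      rw [map_pow_of_eq vK hn, vK.map_one] at h
      have h' : (e : ℤ) * n = 0 := by exact_mod_cast h
      rw [hn, (mul_eq_zero.mp h').resolve_left (by omega)] at hlt
      exact lt_irrefl _ hlt
    have hpow : (1 + (η - 1)) ^ e = 1 := by rw [add_sub_cancel, hη]
    have hd0 : 0 < d := by
      have : 0 < vK (η - 1) := by
        refine map_pos_of_one_add_pow vK e ?_ (vK.map_le_sub hvη vK.map_one.ge) ?_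
        · rw [hvp]; exact_mod_cast hE
        · rw [hpow, sub_self, vK.map_zero]
          exact WithTop.coe_lt_top 0
      rw [hd] at this
      exact_mod_cast this
    have hdE := sub_one_mul_map_eq_of_one_add_pow_eq_one vK e hvp hd hd0 hpow
    have hdt : (e : ℤ) * d = t' := by
      refine mul_left_cancel₀ (by omega : (e : ℤ) - 1 ≠ 0) ?_
      rw [ht', ← hdE]
      ring
    rw [map_sub σ, map_one, sub_sub_sub_cancel_right, hση,
      show algebraMap K F η * α - α = algebraMap K F (η - 1) * α by
        rw [map_sub, map_one]; ring,
      v.map_mul, hvα, add_zero, hext.map_eq hd, hdt, add_sub_cancel]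
  have hcard : Nat.card (F ≃ₐ[K] F) = e := by rw [IsGalois.card_aut_eq_finrank, hfin]
  have : Nontrivial (F ≃ₐ[K] F) := Finite.one_lt_card_iff_nontrivial.mp (hcard ▸ hp.one_lt)
  refine isUpperJump_iff_of_lowerRG ht (fun i hi => ?_) fun i hi => ?_
  · rw [eq_top_iff]
    intro σ _
    by_cases hσ : σ = 1
    · rw [hσ]
      exact one_mem _
    · exact hext.mem_lowerRG_of_le_map_sub hv hfin hlp hb (hmove σ hσ).ge hi
  · rw [eq_bot_iff]
    intro σ hmem
    by_contra hσ
    exact notMem_lowerRG_of_map_sub_eq v hv hvn hb (hmove σ hσ) hi hmem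

end Kummer

/-- Proposition 14, second case. If `ζ_p ∈ K` and `a ∈ K^×` with
`v_K(a) = 0` and `v_K(a-1) = l`, `1 ≤ l < p·e_K/(p-1)`, `gcd(l,p) = 1`, then
`L = K(a^{1/p})` is cyclic of degree `p` with upper ramification jump
`p·e_K/(p-1) - l`. -/
theorem statement_11
    (p : ℕ) [Fact p.Prime]
    (K : Type*) [Field K] [Algebra ℚ_[p] K] [FiniteDimensional ℚ_[p] K]
    (vK : AddValuation K (WithTop ℤ)) (eK : ℕ)
    (hvK : IsPadicValuation p vK eK)
    (hζ : ∃ ζ : K, IsPrimitiveRoot ζ p)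
    (t' : ℤ) (ht' : ((p : ℤ) - 1) * t' = (p : ℤ) * eK)
    (Ω : Type*) [Field Ω] [Algebra K Ω] [IsAlgClosure K Ω]
    (a : K) (ha0 : vK a = ((0 : ℤ) : WithTop ℤ))
    (l : ℕ) (hl1 : 1 ≤ l) (hl2 : (p - 1) * l < p * eK) (hlp : Nat.Coprime l p)
    (hal : vK (a - 1) = ((l : ℤ) : WithTop ℤ))
    (α : Ω) (hα : α ^ p = algebraMap K Ω a)
    (vL : AddValuation ↥(IntermediateField.adjoin K {α}) (WithTop ℤ)) (eL : ℕ)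
    (hvL : IsNormalized vL) (hext : Extends vK vL eL) (hGal : GalInvariant K vL) :
    Module.finrank K ↥(IntermediateField.adjoin K {α}) = p ∧
    IsCyclic (↥(IntermediateField.adjoin K {α}) ≃ₐ[K] ↥(IntermediateField.adjoin K {α})) ∧
    (∀ s : ℤ, IsUpperJump vL hGal s ↔ s = t' - l) := by
  obtain ⟨ζ, hζ⟩ := hζ
  have hint : IsIntegral K α := by
    refine IsIntegral.of_pow (Fact.out : p.Prime).pos ?_
    rw [hα]
    exact isIntegral_algebraMap
  have := IntermediateField.adjoin.finiteDimensional hint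
  exact Extends.kummer_upperJump (α := IntermediateField.AdjoinSimple.gen K α) hvK.2.1
    hvK.map_natCast_prime hζ ht' ha0 hl1 hl2 hlp hal (Subtype.ext (by simpa using hα))
    (IntermediateField.lift_injective _ (by
      rw [IntermediateField.lift_adjoin_simple, IntermediateField.lift_top,
        IntermediateField.AdjoinSimple.coe_gen])) hext hvL hGal

end PaperRam
end
end

section
/- Assume ζ_p ∈ K and let a ∈ K^× with v_K(a) = 0 and v_K(a − 1) = p·e_K/(p−1). Then the extension L = K(a^{1/p}) of K is unramified; in particular, if L ≠ K, its unique upper ramification jump is −1. -/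
noncomputable section

open scoped Classical

namespace PaperRam

variable {K F : Type*} [Field K] [Field F] [Algebra K F]

lemma map_prod_eq_card_nsmul {F ι : Type*} [Field F] (v : AddValuation F (WithTop ℤ))
    (s : Finset ι) (f : ι → F) (c : WithTop ℤ) (h : ∀ i ∈ s, v (f i) = c) :
    v (∏ i ∈ s, f i) = s.card • c := by
  induction s using Finset.induction_on with
  | empty => simp
  | insert i s hi ih =>
    rw [Finset.prod_insert hi, v.map_mul, Finset.card_insert_of_notMem hi, succ_nsmul',
      h i (Finset.mem_insert_self i s), ih fun j hj => h j (Finset.mem_insert_of_mem hj)]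

lemma nsmul_coe_withTop (n : ℕ) (z : ℤ) :
    n • (z : WithTop ℤ) = ((n * z : ℤ) : WithTop ℤ) := by
  rw [← WithTop.coe_nsmul, nsmul_eq_mul]

lemma map_eq_zero_of_map_pow_eq_zero {F : Type*} [Field F] (v : AddValuation F (WithTop ℤ))
    {p : ℕ} (hp : p ≠ 0) {w : F} (hw : v (w ^ p) = 0) : v w = 0 := by
  have hw0 : w ≠ 0 := by
    rintro rfl
    rw [zero_pow hp, v.map_zero] at hw
    exact WithTop.top_ne_zero hw
  obtain ⟨z, hz⟩ := WithTop.ne_top_iff_exists.mp (mt v.top_iff.mp hw0)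
  rw [v.map_pow, ← hz, nsmul_coe_withTop] at hw
  have h : (p * z : ℤ) = 0 := by exact_mod_cast hw
  rw [← hz, (mul_eq_zero.mp h).resolve_left (by exact_mod_cast hp)]
  rfl

lemma map_sub_one_le_map_pow_sub_one {F : Type*} [Field F] (v : AddValuation F (WithTop ℤ))
    {w : F} (hw : v w = 0) (k : ℕ) : v (w - 1) ≤ v (w ^ k - 1) := by
  rw [← mul_geom_sum, v.map_mul]
  refine le_add_of_nonneg_right (v.map_le_sum fun i _ => ?_)
  rw [v.map_pow, hw, smul_zero]

lemma map_sub_one_eq_of_isPrimitiveRoot {F : Type*} [Field F] (v : AddValuation F (WithTop ℤ))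
    {p : ℕ} [hp : Fact p.Prime] {ζ u : F} (hζ : IsPrimitiveRoot ζ p)
    (hu : IsPrimitiveRoot u p) : v (u - 1) = v (ζ - 1) := by
  have key : ∀ {a b : F}, IsPrimitiveRoot a p → IsPrimitiveRoot b p →
      v (a - 1) ≤ v (b - 1) := by
    intro a b ha hb
    have : NeZero p := ⟨hp.out.ne_zero⟩
    obtain ⟨i, -, rfl⟩ := ha.eq_pow_of_pow_eq_one hb.pow_eq_one
    exact map_sub_one_le_map_pow_sub_one v
      (map_eq_zero_of_map_pow_eq_zero v hp.out.ne_zero (by rw [ha.pow_eq_one, v.map_one])) i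
  exact le_antisymm (key hu hζ) (key hζ hu)

lemma isPrimitiveRoot_of_pow_eq_one {F : Type*} [Field F] {p : ℕ} [hp : Fact p.Prime] {u : F}
    (hu : u ^ p = 1) (hu1 : u ≠ 1) : IsPrimitiveRoot u p := by
  rw [← orderOf_eq_prime hu hu1]
  exact IsPrimitiveRoot.orderOf u

/-- The valuation of a prime `p` is `p - 1` times that of `ζ_p - 1`. -/
lemma map_prime_eq_nsmul {F : Type*} [Field F] (v : AddValuation F (WithTop ℤ))
    {p : ℕ} [hp : Fact p.Prime] {ζ : F} (hζ : IsPrimitiveRoot ζ p) :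
    v (p : F) = (p - 1) • v (ζ - 1) := by
  obtain ⟨n, rfl⟩ : ∃ n, p = n + 1 := ⟨p - 1, by have := hp.out.pos; omega⟩
  have h := hζ.prod_one_sub_pow_eq_order
  push_cast
  rw [← h, map_prod_eq_card_nsmul v _ _ (v (ζ - 1)), Finset.card_range]
  intro k hk
  rw [v.map_sub_swap]
  refine map_sub_one_eq_of_isPrimitiveRoot v hζ (hζ.pow_of_coprime _ ?_)
  exact (Nat.coprime_of_lt_prime k.succ_ne_zero
    (Nat.succ_lt_succ (Finset.mem_range.mp hk)) hp.out).symm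

/-- If `b ^ p` is close enough to `1`, then `b` is at least as close to `1` as `ζ_p`. -/
lemma map_sub_one_le_of_map_pow_sub_one {F : Type*} [Field F] (v : AddValuation F (WithTop ℤ))
    {p : ℕ} [hp : Fact p.Prime] {ζ b : F} (hζ : IsPrimitiveRoot ζ p)
    (hb : v (b ^ p - 1) = p • v (ζ - 1)) : v (ζ - 1) ≤ v (b - 1) := by
  by_contra! hlt
  have h := hζ.pow_sub_pow_eq_prod_sub_mul b 1 hp.out.pos
  have hprod : v (b ^ p - 1) = p • v (b - 1) := by
    rw [one_pow] at h
    rw [h, map_prod_eq_card_nsmul v _ _ (v (b - 1)), hζ.card_nthRootsFinset]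
    intro η hη
    have hη1 : η ^ p = 1 := (Polynomial.mem_nthRootsFinset hp.out.pos 1).mp hη
    rw [mul_one, show b - η = (b - 1) - (η - 1) by ring]
    refine v.map_sub_eq_of_lt_left (lt_of_lt_of_le hlt ?_)
    by_cases h1 : η = 1
    · simp [h1]
    · exact (map_sub_one_eq_of_isPrimitiveRoot v hζ (isPrimitiveRoot_of_pow_eq_one hη1 h1)).ge
  have hne : v (ζ - 1) ≠ ⊤ :=
    mt v.top_iff.mp (sub_ne_zero.mpr (hζ.ne_one hp.out.one_lt))
  obtain ⟨m, hm⟩ := WithTop.ne_top_iff_exists.mp hne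
  obtain ⟨n, hn⟩ := WithTop.ne_top_iff_exists.mp (ne_top_of_lt hlt)
  rw [hb, ← hm, ← hn, nsmul_coe_withTop, nsmul_coe_withTop] at hprod
  rw [← hm, ← hn] at hlt
  have h1 : (p * m : ℤ) = p * n := by exact_mod_cast hprod
  have h2 : n < m := by exact_mod_cast hlt
  have h3 := mul_left_cancel₀ (by exact_mod_cast hp.out.ne_zero) h1
  omega

/-- The valuation of an element of the base field which is positive is at least the
ramification index. -/
lemma ramification_le_map_algebraMap {K F : Type*} [Field K] [Field F] [Algebra K F]
    {vK : AddValuation K (WithTop ℤ)} {vF : AddValuation F (WithTop ℤ)} {e : ℕ}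
    (hext : Extends vK vF e) {c : K} (hc : 1 ≤ vF (algebraMap K F c)) :
    ((e : ℤ) : WithTop ℤ) ≤ vF (algebraMap K F c) := by
  by_cases h0 : c = 0
  · simp [h0]
  obtain ⟨z, hz⟩ := WithTop.ne_top_iff_exists.mp (mt vK.top_iff.mp h0)
  rw [hext.2, ← hz, nsmul_coe_withTop] at hc ⊢
  have hc' : (1 : ℤ) ≤ e * z := by exact_mod_cast hc
  have he : (0 : ℤ) < e := by exact_mod_cast hext.1
  have hz1 : 0 < z := pos_of_mul_pos_right (by omega) he.le
  exact_mod_cast (by nlinarith : (e : ℤ) ≤ e * z)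

/-- If some integral element is moved by a unit by every nontrivial automorphism, then the
ramification index is `1`. -/
lemma ramification_eq_one_of_map_sub_eq_zero {K F : Type*} [Field K] [Field F] [Algebra K F]
    [FiniteDimensional K F] [IsGalois K F]
    {vK : AddValuation K (WithTop ℤ)} {vF : AddValuation F (WithTop ℤ)} {e : ℕ}
    (hnorm : IsNormalized vF) (hext : Extends vK vF e) (hGal : GalInvariant K vF)
    {x : F} (hx : 0 ≤ vF x) (hσx : ∀ σ : F ≃ₐ[K] F, σ ≠ 1 → vF (σ x - x) = 0) :
    e = 1 := by
  have key : ∀ S : Finset (F ≃ₐ[K] F), 1 ∉ S → ∀ y : F, 1 ≤ vF y →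
      ((e : ℤ) : WithTop ℤ) ≤
        vF (∑ σ : F ≃ₐ[K] F, σ y * ∏ τ ∈ S, ((σ x - τ x) / (x - τ x))) := by
    intro S
    induction S using Finset.induction_on with
    | empty =>
      intro _ y hy
      simp only [Finset.prod_empty, mul_one]
      rw [← trace_eq_sum_automorphisms]
      refine ramification_le_map_algebraMap hext ?_
      rw [trace_eq_sum_automorphisms]
      exact vF.map_le_sum fun σ _ => by rwa [hGal]
    | insert τ S hτ ih =>
      intro h1 y hy
      rw [Finset.mem_insert, not_or] at h1
      have hu : vF (x - τ x) = 0 := by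
        rw [vF.map_sub_swap]
        exact hσx τ (Ne.symm h1.1)
      have hsum : ∑ σ : F ≃ₐ[K] F, σ y * ∏ ρ ∈ insert τ S, ((σ x - ρ x) / (x - ρ x)) =
          (x - τ x)⁻¹ *
            (∑ σ : F ≃ₐ[K] F, σ (y * x) * ∏ ρ ∈ S, ((σ x - ρ x) / (x - ρ x)) -
              τ x * ∑ σ : F ≃ₐ[K] F, σ y * ∏ ρ ∈ S, ((σ x - ρ x) / (x - ρ x))) := by
        rw [Finset.mul_sum, ← Finset.sum_sub_distrib, Finset.mul_sum]
        refine Finset.sum_congr rfl fun σ _ => ?_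
        rw [Finset.prod_insert hτ, map_mul]
        ring
      have hinv : vF (x - τ x)⁻¹ = 0 := by rw [vF.map_inv, hu, neg_zero]
      rw [hsum, vF.map_mul, hinv, zero_add]
      refine vF.map_le_sub (ih h1.2 _ ?_) ?_
      · rw [vF.map_mul]
        exact le_add_of_le_of_nonneg hy hx
      · rw [vF.map_mul, hGal]
        exact le_add_of_nonneg_of_le hx (ih h1.2 y hy)
  obtain ⟨y, hy⟩ := hnorm 1
  have h := key (Finset.univ.erase 1) (Finset.notMem_erase _ _) y hy.ge
  rw [Finset.sum_eq_single 1] at h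
  · rw [Finset.prod_congr rfl (g := fun _ => 1)] at h
    · rw [Finset.prod_const_one, mul_one, AlgEquiv.one_apply, hy] at h
      have h' : (e : ℤ) ≤ 1 := by exact_mod_cast h
      have := hext.1
      omega
    · intro τ hτ
      refine div_self fun h0 => ?_
      have := hσx τ (Finset.ne_of_mem_erase hτ)
      rw [vF.map_sub_swap, show x - τ x = 0 from h0, vF.map_zero] at this
      exact WithTop.top_ne_zero this
  · intro σ _ hσ
    rw [Finset.prod_eq_zero (Finset.mem_erase.mpr ⟨hσ, Finset.mem_univ σ⟩) (by simp), mul_zero]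
  · simp

lemma lowerRG_eq_bot_of_map_sub_eq_zero {v : AddValuation F (WithTop ℤ)}
    (hv : GalInvariant K v) {x : F} (hx : 0 ≤ v x)
    (hσx : ∀ σ : F ≃ₐ[K] F, σ ≠ 1 → v (σ x - x) = 0) {i : ℤ} (hi : 0 ≤ i) :
    lowerRG v hv i = ⊥ := by
  refine (Subgroup.eq_bot_iff_forall _).mpr fun σ hσ => ?_
  by_contra h1
  have h : ((i + 1 : ℤ) : WithTop ℤ) ≤ v (σ x - x) := hσ x hx
  rw [hσx σ h1] at h
  have h' : i + 1 ≤ 0 := by exact_mod_cast h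
  omega

lemma lowerRG_eq_top {v : AddValuation F (WithTop ℤ)} (hv : GalInvariant K v) {i : ℤ}
    (hi : i ≤ -1) : lowerRG v hv i = ⊤ := by
  refine (Subgroup.eq_top_iff' _).mpr fun σ x hx => ?_
  have h0 : ((i + 1 : ℤ) : WithTop ℤ) ≤ 0 := by exact_mod_cast (by omega : i + 1 ≤ 0)
  exact h0.trans (v.map_le_sub (by rwa [hv]) hx)

lemma upperRG_of_nonpos {v : AddValuation F (WithTop ℤ)} (hv : GalInvariant K v) {u : ℤ}
    (hu : u ≤ 0) : upperRG v hv u = lowerRG v hv u := by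
  have h : IsLeast {n : ℤ | (u : ℚ) ≤ herbrandPhi v hv n} u := by
    refine ⟨by simp [herbrandPhi, hu], fun n hn => ?_⟩
    by_contra! hlt
    have hn0 : n ≤ 0 := by omega
    simp only [Set.mem_ofPred_eq, herbrandPhi, hn0, if_true, Int.cast_le] at hn
    omega
  rw [upperRG, h.csInf_eq]

lemma upperRG_eq_bot_of_nonneg {v : AddValuation F (WithTop ℤ)} (hv : GalInvariant K v)
    (hbot : ∀ i : ℤ, 0 ≤ i → lowerRG v hv i = ⊥) {u : ℤ} (hu : 0 ≤ u) :
    upperRG v hv u = ⊥ := by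
  refine hbot _ ?_
  rcases Set.eq_empty_or_nonempty {n : ℤ | (u : ℚ) ≤ herbrandPhi v hv n} with h | h
  · rw [h, Int.csInf_empty]
  · refine le_csInf h fun n hn => ?_
    by_contra! hlt
    have hn' : (u : ℚ) ≤ herbrandPhi v hv n := hn
    simp only [herbrandPhi, hlt.le, if_true, Int.cast_le] at hn'
    omega

/-- A nontrivial extension with trivial inertia has `-1` as its only upper jump. -/
lemma isUpperJump_iff_of_lowerRG_eq_bot {v : AddValuation F (WithTop ℤ)}
    (hv : GalInvariant K v) (hbot : ∀ i : ℤ, 0 ≤ i → lowerRG v hv i = ⊥)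
    [Nontrivial (F ≃ₐ[K] F)] (s : ℤ) : IsUpperJump v hv s ↔ s = -1 := by
  constructor
  · intro h
    by_contra hs
    refine h (s + 1) (by omega) ?_
    rcases lt_or_ge s 0 with hlt | hge
    · rw [upperRG_of_nonpos hv (by omega), upperRG_of_nonpos hv (by omega),
        lowerRG_eq_top hv (by omega), lowerRG_eq_top hv (by omega)]
    · rw [upperRG_eq_bot_of_nonneg hv hbot (by omega), upperRG_eq_bot_of_nonneg hv hbot hge]
  · rintro rfl u hu
    rw [upperRG_eq_bot_of_nonneg hv hbot (by omega), upperRG_of_nonpos hv (by omega),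
      lowerRG_eq_top hv le_rfl]
    exact bot_ne_top

/-- A radical extension generated by a `p`-th root is normal when `ζ_p` lies in the base. -/
lemma normal_adjoin_of_pow_eq {K Ω : Type*} [Field K] [Field Ω] [Algebra K Ω] [IsAlgClosure K Ω]
    {p : ℕ} [hp : Fact p.Prime] {ζ : K} (hζ : IsPrimitiveRoot ζ p) {a : K} {α : Ω}
    (hα : α ^ p = algebraMap K Ω a) : Normal K (IntermediateField.adjoin K {α}) := by
  have : Normal K Ω := IsAlgClosure.normal K Ω
  rw [IntermediateField.normal_iff_forall_map_le']
  intro σ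
  rw [IntermediateField.adjoin_map, IntermediateField.adjoin_le_iff]
  rintro _ ⟨y, hy, rfl⟩
  rw [Set.mem_singleton_iff.mp hy]
  have hmem : α ∈ IntermediateField.adjoin K {α} := IntermediateField.mem_adjoin_simple_self K α
  have hpow : (σ α) ^ p = α ^ p := by rw [← map_pow, hα, AlgEquiv.commutes]
  by_cases h0 : α = 0
  · simp [h0]
  have : NeZero p := ⟨hp.out.ne_zero⟩
  have hζ' : IsPrimitiveRoot (algebraMap K Ω ζ) p :=
    hζ.map_of_injective (algebraMap K Ω).injective
  obtain ⟨i, -, hi⟩ := hζ'.eq_pow_of_pow_eq_one (ξ := σ α / α)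
    (by rw [div_pow, hpow, div_self (pow_ne_zero _ h0)])
  have : σ α = algebraMap K Ω (ζ ^ i) * α := by
    rw [map_pow, hi, div_mul_cancel₀ _ h0]
  change σ α ∈ _
  rw [this]
  exact mul_mem (algebraMap_mem _ _) hmem

lemma exists_map_sub_eq_zero {K F : Type*} [Field K] [Field F] [Algebra K F]
    {v : AddValuation F (WithTop ℤ)} {p : ℕ} [hp : Fact p.Prime] {ζ : K}
    (hζ : IsPrimitiveRoot ζ p) {a : K} {β : F} (hβ : β ^ p = algebraMap K F a) (hβv : v β = 0)
    (hβp : v (β ^ p - 1) = p • v (algebraMap K F ζ - 1))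
    (hσβ : ∀ σ : F ≃ₐ[K] F, σ ≠ 1 → σ β ≠ β) :
    ∃ x : F, 0 ≤ v x ∧ ∀ σ : F ≃ₐ[K] F, σ ≠ 1 → v (σ x - x) = 0 := by
  set μ := algebraMap K F ζ with hμ
  have hμp : IsPrimitiveRoot μ p := hζ.map_of_injective (algebraMap K F).injective
  have hμ0 : μ - 1 ≠ 0 := sub_ne_zero.mpr (hμp.ne_one hp.out.one_lt)
  have hcancel : v (μ - 1) ≠ ⊤ := mt v.top_iff.mp hμ0
  have hβ0 : β ≠ 0 := by
    intro h
    rw [h, v.map_zero] at hβv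
    exact WithTop.top_ne_zero hβv
  refine ⟨(β - 1) / (μ - 1), ?_, fun σ hσ => ?_⟩
  · refine (WithTop.add_le_add_iff_right hcancel).mp ?_
    rw [← v.map_mul, div_mul_cancel₀ _ hμ0, zero_add]
    exact map_sub_one_le_of_map_pow_sub_one v hμp hβp
  · have hpow : (σ β / β) ^ p = 1 := by
      rw [div_pow, ← map_pow, hβ, AlgEquiv.commutes, div_self (hβ ▸ pow_ne_zero _ hβ0)]
    have hroot : IsPrimitiveRoot (σ β / β) p :=
      isPrimitiveRoot_of_pow_eq_one hpow fun h => hσβ σ hσ ((div_eq_one_iff_eq hβ0).mp h)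
    have hσμ : σ μ = μ := σ.commutes ζ
    have hmul : (σ ((β - 1) / (μ - 1)) - (β - 1) / (μ - 1)) * (μ - 1) =
        β * (σ β / β - 1) := by
      rw [map_div₀, map_sub, map_sub, map_one, hσμ]
      field_simp
      ring
    refine (WithTop.add_left_inj hcancel).mp ?_
    rw [← v.map_mul, mul_comm, hmul, v.map_mul, hβv, zero_add, add_zero]
    exact map_sub_one_eq_of_isPrimitiveRoot v hμp hroot

/-- Proposition 14, third case. If `ζ_p ∈ K` and `a ∈ K^×` with
`v_K(a) = 0` and `v_K(a-1) = p·e_K/(p-1)`, then `L = K(a^{1/p})` is unramified over `K`;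
in particular, if `L ≠ K`, its unique upper ramification jump is `-1`. -/
theorem statement_12
    (p : ℕ) [Fact p.Prime]
    (K : Type*) [Field K] [Algebra ℚ_[p] K] [FiniteDimensional ℚ_[p] K]
    (vK : AddValuation K (WithTop ℤ)) (eK : ℕ)
    (hvK : IsPadicValuation p vK eK)
    (hζ : ∃ ζ : K, IsPrimitiveRoot ζ p)
    (t' : ℤ) (ht' : ((p : ℤ) - 1) * t' = (p : ℤ) * eK)
    (Ω : Type*) [Field Ω] [Algebra K Ω] [IsAlgClosure K Ω]
    (a : K) (ha0 : vK a = ((0 : ℤ) : WithTop ℤ))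
    (hal : vK (a - 1) = (t' : WithTop ℤ))
    (α : Ω) (hα : α ^ p = algebraMap K Ω a)
    (vL : AddValuation ↥(IntermediateField.adjoin K {α}) (WithTop ℤ)) (eL : ℕ)
    (hvL : IsNormalized vL) (hext : Extends vK vL eL) (hGal : GalInvariant K vL) :
    eL = 1 ∧
    (IntermediateField.adjoin K {α} ≠ ⊥ →
      ∀ s : ℤ, IsUpperJump vL hGal s ↔ s = -1) := by
  have hp : Fact p.Prime := inferInstance
  obtain ⟨ζ, hζ⟩ := hζ
  have : CharZero K := charZero_of_injective_algebraMap (algebraMap ℚ_[p] K).injective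
  have : Normal K (IntermediateField.adjoin K {α}) := normal_adjoin_of_pow_eq hζ hα
  have hint : IsIntegral K α :=
    IsIntegral.of_pow hp.out.pos (hα ▸ isIntegral_algebraMap)
  have : FiniteDimensional K (IntermediateField.adjoin K {α}) :=
    IntermediateField.adjoin.finiteDimensional hint
  have : IsGalois K (IntermediateField.adjoin K {α}) := ⟨⟩
  have hz0 : ζ - 1 ≠ 0 := sub_ne_zero.mpr (hζ.ne_one hp.out.one_lt)
  obtain ⟨z, hz⟩ := WithTop.ne_top_iff_exists.mp (mt vK.top_iff.mp hz0)
  have hpz : ((p : ℤ) - 1) * z = eK := by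
    have h1 := map_prime_eq_nsmul vK hζ
    have h2 := hvK.2.2 (p : ℚ_[p]) (by exact_mod_cast hp.out.ne_zero)
    rw [map_natCast, h1, ← hz, nsmul_coe_withTop, Padic.valuation_p, mul_one,
      Nat.cast_sub hp.out.one_le, Nat.cast_one] at h2
    exact_mod_cast h2
  have ht : t' = p * z := by
    have h1 : (p : ℤ) - 1 ≠ 0 := by
      have := hp.out.one_lt
      omega
    apply mul_left_cancel₀ h1
    rw [ht', ← hpz]
    ring
  have hβ : IntermediateField.AdjoinSimple.gen K α ^ p =
      algebraMap K (IntermediateField.adjoin K {α}) a := Subtype.ext hα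
  obtain ⟨x, hx, hσx⟩ := exists_map_sub_eq_zero (v := vL) hζ hβ
    (map_eq_zero_of_map_pow_eq_zero vL hp.out.ne_zero
      (by rw [hβ, hext.2, ha0, WithTop.coe_zero, smul_zero]))
    (by
      rw [hβ, ← map_one (algebraMap K (IntermediateField.adjoin K {α})), ← map_sub, ← map_sub,
        hext.2, hext.2, hal, ht, ← hz, ← nsmul_coe_withTop, smul_comm])
    (by
      intro σ hσ h
      refine hσ (AlgEquiv.ext fun y => ?_)
      have heq : (σ : _ →ₐ[K] (IntermediateField.adjoin K {α})) = AlgHom.id K _ := by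
        refine IntermediateField.adjoin_algHom_ext K fun y hy => ?_
        obtain rfl : y = α := hy
        exact h
      exact DFunLike.congr_fun heq y)
  refine ⟨ramification_eq_one_of_map_sub_eq_zero hvL hext hGal hx hσx, fun hne s => ?_⟩
  have : Nontrivial ((IntermediateField.adjoin K {α}) ≃ₐ[K] (IntermediateField.adjoin K {α})) := by
    rw [← Finite.one_lt_card_iff_nontrivial, IsGalois.card_aut_eq_finrank]
    have h1 := mt IntermediateField.finrank_eq_one_iff.mp hne
    have h2 : 0 < Module.finrank K (IntermediateField.adjoin K {α}) := Module.finrank_pos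
    omega
  exact isUpperJump_iff_of_lowerRG_eq_bot hGal
    (fun i hi => lowerRG_eq_bot_of_map_sub_eq_zero hGal hx hσx hi) s
end PaperRam
end
end
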